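/- arXiv:1603.00754 — 6 statements merged into one kernel-verified Lean document; each statement's English description precedes it below -/
import Mathlib

section
/- Let A be a finite nonempty alphabet, l ≥ 1, and C ⊆ A^{Q_l} a set of patterns on the square Q_l = {0,…,l−1}². For every configuration x : ℤ² → A, x belongs to X_C if and only if for every n ∈ ℤ the ordered pair of consecutive strips (R_n(x), R_{n+1}(x)) is an admissible pair. -/
namespace SFT2

variable {A : Type*}

/-- The square `Q_l = {0,…,l−1}²` as a subset of `ℤ²`. -/
def Q (l : ℕ) : Set (ℤ × ℤ) :=
  {s | (0 ≤ s.1 ∧ s.1 < (l : ℤ)) ∧ (0 ≤ s.2 ∧ s.2 < (l : ℤ))}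

/-- A pattern `p : Q l → A` occurs in a function `x : T → A`:
there is `b ∈ ℤ²` with `b + Q l ⊆ T` such that `x (b + s) = p s` on `Q l`. -/
def OccursIn (l : ℕ) (p : Q l → A) (T : Set (ℤ × ℤ)) (x : T → A) : Prop :=
  ∃ b : ℤ × ℤ, ∃ h : ∀ s ∈ Q l, b + s ∈ T,
    ∀ s : Q l, x ⟨b + s.1, h s.1 s.2⟩ = p s

/-- A pattern `p : Q l → A` occurs in a full configuration `x : ℤ² → A`. -/
def OccursCfg (l : ℕ) (p : Q l → A) (x : ℤ × ℤ → A) : Prop :=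
  ∃ b : ℤ × ℤ, ∀ s : Q l, x (b + s.1) = p s

/-- The subshift of finite type determined by the forbidden set `C ⊆ A^{Q_l}`. -/
def XC (l : ℕ) (C : Set (Q l → A)) : Set (ℤ × ℤ → A) :=
  {x | ∀ p ∈ C, ¬ OccursCfg l p x}

/-- The domain `ℤ × {0,…,l−1}` of strips. -/
def StripDom (l : ℕ) : Set (ℤ × ℤ) := {s | 0 ≤ s.2 ∧ s.2 < (l : ℤ)}

/-- The domain `ℤ × {0,…,2l−1}` of stacks of two strips. -/
def StackDom (l : ℕ) : Set (ℤ × ℤ) := {s | 0 ≤ s.2 ∧ s.2 < 2 * (l : ℤ)}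

/-- The stack of two strips: `u` on rows `0,…,l−1` and `v` on rows `l,…,2l−1`. -/
def stack (l : ℕ) (u v : StripDom l → A) : StackDom l → A :=
  fun s =>
    if h : s.1.2 < (l : ℤ) then u ⟨s.1, ⟨s.2.1, h⟩⟩
    else v ⟨(s.1.1, s.1.2 - l), ⟨by have := s.2.1; omega, by have := s.2.2; omega⟩⟩

/-- A strip `u` is admissible if no pattern of `C` occurs in it. -/
def AdmissibleStrip (l : ℕ) (C : Set (Q l → A)) (u : StripDom l → A) : Prop :=
  ∀ p ∈ C, ¬ OccursIn l p (StripDom l) u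

/-- `(u,v)` is an admissible pair if no pattern of `C` occurs in `stack u v`. -/
def AdmissiblePair (l : ℕ) (C : Set (Q l → A)) (u v : StripDom l → A) : Prop :=
  ∀ p ∈ C, ¬ OccursIn l p (StackDom l) (stack l u v)

/-- The `n`-th strip of a configuration: `R_n(x)(i,j) = x(i, n·l + j)`. -/
def R (l : ℕ) (x : ℤ × ℤ → A) (n : ℤ) : StripDom l → A :=
  fun s => x (s.1.1, n * l + s.1.2)

/-- A family `B` of admissible strips is complementary if every `u ∈ B` has
`v, w ∈ B` with `(u,v)` and `(w,u)` admissible pairs. -/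
def Complementary (l : ℕ) (C : Set (Q l → A)) (B : Set (StripDom l → A)) : Prop :=
  (∀ u ∈ B, AdmissibleStrip l C u) ∧
    ∀ u ∈ B, (∃ v ∈ B, AdmissiblePair l C u v) ∧ ∃ w ∈ B, AdmissiblePair l C w u

end SFT2

namespace SFT2

theorem stack_R {A : Type*} (l : ℕ) (x : ℤ × ℤ → A) (n : ℤ) (s : StackDom l) :
    stack l (R l x n) (R l x (n + 1)) s = x (s.1.1, n * l + s.1.2) := by
  unfold stack R
  split_ifs
  · rfl
  · exact congrArg x (Prod.ext rfl (by ring))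

/-- A pattern occurs in the stack of two consecutive strips exactly when it occurs in the
configuration at a position whose height lies in the corresponding window. -/
theorem occursIn_stack_R {A : Type*} (l : ℕ) (p : Q l → A) (x : ℤ × ℤ → A) (n : ℤ) :
    OccursIn l p (StackDom l) (stack l (R l x n) (R l x (n + 1))) ↔
      ∃ b : ℤ × ℤ, (∀ s ∈ Q l, b + s ∈ StackDom l) ∧
        ∀ s : Q l, x ((b.1, n * l + b.2) + s.1) = p s := by
  simp only [OccursIn, stack_R, exists_prop, Prod.add_def, add_assoc]

end SFT2

/-- a configuration `x : ℤ² → A` belongs to `X_C` iff every pair of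
consecutive strips `(R_n(x), R_{n+1}(x))` is an admissible pair. -/
theorem stmt2 {A : Type*} [Finite A] [Nonempty A] (l : ℕ) (hl : 1 ≤ l)
    (C : Set (SFT2.Q l → A)) (x : ℤ × ℤ → A) :
    x ∈ SFT2.XC l C ↔
      ∀ n : ℤ, SFT2.AdmissiblePair l C (SFT2.R l x n) (SFT2.R l x (n + 1)) := by
  constructor
  · intro hx n p hp hocc
    obtain ⟨b, -, hb⟩ := (SFT2.occursIn_stack_R l p x n).1 hocc
    exact hx p hp ⟨_, hb⟩
  · rintro h p hp ⟨b, hb⟩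
    have hl' : (0 : ℤ) < l := by exact_mod_cast hl
    refine h (b.2 / l) p hp ((SFT2.occursIn_stack_R l p x _).2 ⟨(b.1, b.2 % l), ?_, ?_⟩)
    · rintro s ⟨-, hs₀, hs₁⟩
      have h₀ := Int.emod_nonneg b.2 hl'.ne'
      have h₁ := Int.emod_lt_of_pos b.2 hl'
      constructor <;> simp only [Prod.snd_add] <;> omega
    · simpa only [Int.ediv_mul_add_emod] using hb
end

section
/- Let A be a finite nonempty alphabet, l ≥ 1, and C ⊆ A^{Q_l} with Q_l = {0,…,l−1}². The subshift X_C is nonempty if and only if there exists a nonempty complementary family B₀ of admissible strips, i.e., a nonempty set B₀ of admissible strips such that for every u ∈ B₀ there exist v, w ∈ B₀ for which (u,v) and (w,u) are admissible pairs. -/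
namespace SFT2

theorem XC.admissibleStrip_R {A : Type*} {l : ℕ} {C : Set (Q l → A)} {x : ℤ × ℤ → A}
    (hx : x ∈ XC l C) (n : ℤ) : AdmissibleStrip l C (R l x n) := by
  rintro p hp ⟨b, hb, h⟩
  refine hx p hp ⟨(b.1, n * l + b.2), fun s => ?_⟩
  rw [← h s]
  exact congrArg x (Prod.ext rfl (add_assoc _ _ _))

theorem XC.admissiblePair_R {A : Type*} {l : ℕ} {C : Set (Q l → A)} {x : ℤ × ℤ → A}
    (hx : x ∈ XC l C) (n : ℤ) : AdmissiblePair l C (R l x n) (R l x (n + 1)) := by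
  rintro p hp ⟨b, hb, h⟩
  refine hx p hp ⟨(b.1, n * l + b.2), fun s => ?_⟩
  rw [← h s, stack_R]
  exact congrArg x (Prod.ext rfl (add_assoc _ _ _))

/-- The configuration whose strips are the `z n`. -/
def glue {A : Type*} (l : ℕ) (hl : 1 ≤ l) (z : ℤ → StripDom l → A) : ℤ × ℤ → A :=
  fun s => z (s.2 / l) ⟨(s.1, s.2 % l),
    Int.emod_nonneg _ (by omega), Int.emod_lt_of_pos _ (by omega)⟩

theorem R_glue {A : Type*} (l : ℕ) (hl : 1 ≤ l) (z : ℤ → StripDom l → A) (n : ℤ) :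
    R l (glue l hl z) n = z n := by
  funext ⟨⟨i, j⟩, hj⟩
  have h0 : 0 ≤ j := hj.1
  have h1 : j < l := hj.2
  have hdiv : (n * l + j) / (l : ℤ) = n := by
    rw [add_comm, Int.add_mul_ediv_right _ _ (by omega), Int.ediv_eq_zero_of_lt h0 h1, zero_add]
  have hmod : (n * l + j) % (l : ℤ) = j := by
    rw [add_comm, Int.add_mul_emod_self_right, Int.emod_eq_of_lt h0 h1]
  simp only [R, glue, hdiv, hmod]

theorem mem_XC_of_admissiblePair_R {A : Type*} {l : ℕ} (hl : 1 ≤ l) {C : Set (Q l → A)}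
    {x : ℤ × ℤ → A} (hx : ∀ n, AdmissiblePair l C (R l x n) (R l x (n + 1))) :
    x ∈ XC l C := by
  rintro p hp ⟨b, h⟩
  have h0 : 0 ≤ b.2 % (l : ℤ) := Int.emod_nonneg _ (by omega)
  have h1 : b.2 % (l : ℤ) < l := Int.emod_lt_of_pos _ (by omega)
  refine hx (b.2 / l) p hp ⟨(b.1, b.2 % l), fun s hs => ?_, fun s => ?_⟩
  · obtain ⟨-, hs0, hs1⟩ := hs
    constructor <;> simp only [Prod.snd_add] <;> omega
  · rw [stack_R, ← h s]
    congr 1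
    ext
    · rfl
    · simp only [Prod.snd_add, ← add_assoc]
      rw [Int.ediv_mul_add_emod]

end SFT2

/-- A relation that is total in both directions admits a bi-infinite chain. -/
theorem exists_int_chain {α : Type*} [Nonempty α] (r : α → α → Prop)
    (hnext : ∀ a, ∃ b, r a b) (hprev : ∀ a, ∃ b, r b a) :
    ∃ z : ℤ → α, ∀ n, r (z n) (z (n + 1)) := by
  choose f hf using hnext
  choose g hg using hprev
  let a : α := Classical.arbitrary α
  refine ⟨fun n => Int.casesOn n (fun k => f^[k] a) (fun k => g^[k + 1] a), fun n => ?_⟩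
  match n with
  | .ofNat k =>
    change r (f^[k] a) (f^[k + 1] a)
    rw [Function.iterate_succ_apply']
    exact hf _
  | .negSucc 0 => exact hg a
  | .negSucc (k + 1) =>
    change r (g^[k + 2] a) (g^[k + 1] a)
    rw [Function.iterate_succ_apply']
    exact hg _

/-- `X_C` is nonempty iff there is a nonempty complementary family of
admissible strips. -/
theorem stmt4 {A : Type*} [Finite A] [Nonempty A] (l : ℕ) (hl : 1 ≤ l)
    (C : Set (SFT2.Q l → A)) :
    (SFT2.XC l C).Nonempty ↔
      ∃ B : Set (SFT2.StripDom l → A), B.Nonempty ∧ SFT2.Complementary l C B := by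
  constructor
  · rintro ⟨x, hx⟩
    refine ⟨Set.range (SFT2.R l x), Set.range_nonempty _, ?_, ?_⟩
    · rintro _ ⟨n, rfl⟩
      exact SFT2.XC.admissibleStrip_R hx n
    · rintro _ ⟨n, rfl⟩
      refine ⟨⟨_, ⟨n + 1, rfl⟩, SFT2.XC.admissiblePair_R hx n⟩, _, ⟨n - 1, rfl⟩, ?_⟩
      simpa using SFT2.XC.admissiblePair_R hx (n - 1)
  · rintro ⟨B, hB, -, hpair⟩
    have : Nonempty B := hB.to_subtype
    obtain ⟨z, hz⟩ := exists_int_chain (fun u v : B => SFT2.AdmissiblePair l C u v)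
      (fun u => by simpa using (hpair u u.2).1) (fun u => by simpa using (hpair u u.2).2)
    refine ⟨SFT2.glue l hl fun n => z n, SFT2.mem_XC_of_admissiblePair_R hl fun n => ?_⟩
    simpa only [SFT2.R_glue] using hz n
end

section
/- Let A be a finite nonempty alphabet, l ≥ 1, and C ⊆ A^{Q_l} with Q_l = {0,…,l−1}². A strip u : ℤ × {0,…,l−1} → A is admissible if and only if for every n ∈ ℤ the restriction of u to {n·l, …, (n+2)·l − 1} × {0,…,l−1} contains no occurrence of a pattern of C. Consequently, the map sending a strip u to its sequence of blocks (B_n(u))_{n∈ℤ}, where B_n(u) ∈ A^{{0,…,l−1}²} is defined by B_n(u)(i,j) = u(n·l + i, j), is a bijection from the set of admissible strips onto a one-dimensional vertex shift over the finite alphabet A^{{0,…,l−1}²} whose transition relation allows (p,q) exactly when the 2l-by-l block formed by placing q to the right of p contains no occurrence of a pattern of C. -/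
namespace SFT2

variable {A : Type*}

/-- The window `{n·l,…,(n+2)·l − 1} × {0,…,l−1}` inside the strip domain. -/
def Window (l : ℕ) (n : ℤ) : Set (ℤ × ℤ) :=
  {s | (n * l ≤ s.1 ∧ s.1 < (n + 2) * l) ∧ (0 ≤ s.2 ∧ s.2 < (l : ℤ))}

/-- The restriction of a strip `u` to the window `Window l n`. -/
def restrictWindow (l : ℕ) (n : ℤ) (u : StripDom l → A) : Window l n → A :=
  fun s => u ⟨s.1, s.2.2⟩

/-- The `n`-th block of a strip: `B_n(u)(i,j) = u(n·l + i, j)` for `(i,j) ∈ Q_l`. -/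
def block (l : ℕ) (u : StripDom l → A) (n : ℤ) : Q l → A :=
  fun s => u ⟨(n * l + s.1.1, s.1.2), s.2.2⟩

/-- The domain `{0,…,2l−1} × {0,…,l−1}` of the horizontal concatenation of two
blocks on `Q_l`. -/
def HDom (l : ℕ) : Set (ℤ × ℤ) :=
  {s | (0 ≤ s.1 ∧ s.1 < 2 * (l : ℤ)) ∧ (0 ≤ s.2 ∧ s.2 < (l : ℤ))}

/-- The horizontal concatenation of two blocks `p, q : Q l → A` (`q` placed to the
right of `p`). -/
def hcat (l : ℕ) (p q : Q l → A) : HDom l → A :=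
  fun s =>
    if h : s.1.1 < (l : ℤ) then p ⟨s.1, ⟨⟨s.2.1.1, h⟩, s.2.2⟩⟩
    else q ⟨(s.1.1 - l, s.1.2),
      ⟨⟨by have := s.2.1.1; omega, by have := s.2.1.2; omega⟩, s.2.2⟩⟩

/-- The transition relation on blocks: `(p,q)` is allowed exactly when no pattern of
`C` occurs in the horizontal concatenation of `p` and `q`. -/
def BlockRel (l : ℕ) (C : Set (Q l → A)) (p q : Q l → A) : Prop :=
  ∀ c ∈ C, ¬ OccursIn l c (HDom l) (hcat l p q)

end SFT2

namespace SFT2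

/-- Occurrences are preserved by translating the domain into another one on which the
values agree. -/
theorem OccursIn.translate {A : Type*} {l : ℕ} {p : Q l → A} {T T' : Set (ℤ × ℤ)}
    {x : T → A} {x' : T' → A} (c : ℤ × ℤ) (hT : ∀ s ∈ T, c + s ∈ T')
    (hx : ∀ s : T, x' ⟨c + s.1, hT s.1 s.2⟩ = x s) (h : OccursIn l p T x) :
    OccursIn l p T' x' := by
  obtain ⟨b, hb, hp⟩ := h
  refine ⟨c + b, fun s hs => by rw [add_assoc]; exact hT _ (hb s hs), fun s => ?_⟩
  rw [← hp s, ← hx]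
  congr 1
  exact Subtype.ext (add_assoc _ _ _)

theorem occursIn_strip_iff {A : Type*} {l : ℕ} (hl : 1 ≤ l) (p : Q l → A)
    (u : StripDom l → A) :
    OccursIn l p (StripDom l) u ↔
      ∃ n : ℤ, OccursIn l p (Window l n) (restrictWindow l n u) := by
  constructor
  · rintro ⟨b, hb, hp⟩
    have hl' : (0 : ℤ) < l := by omega
    refine ⟨b.1 / l, b, fun s hs => ⟨?_, hb s hs⟩, fun s => hp s⟩
    have h₁ := Int.emod_add_mul_ediv b.1 l
    have h₂ := Int.emod_nonneg b.1 hl'.ne'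
    have h₃ := Int.emod_lt_of_pos b.1 hl'
    have h₄ := hs.1
    simp only [Prod.fst_add]
    constructor <;> linarith
  · rintro ⟨n, h⟩
    refine h.translate 0 (fun s hs => ?_) fun s => ?_
    · rw [zero_add]
      exact hs.2
    · exact congrArg u (Subtype.ext (zero_add _))

theorem hcat_block_apply {A : Type*} {l : ℕ} (u : StripDom l → A) (n : ℤ) (s : HDom l) :
    hcat l (block l u n) (block l u (n + 1)) s = u ⟨(n * l + s.1.1, s.1.2), s.2.2⟩ := by
  unfold hcat block
  split_ifs with h
  · rfl
  · congr 3
    ring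

theorem occursIn_window_iff {A : Type*} {l : ℕ} (p : Q l → A) (u : StripDom l → A) (n : ℤ) :
    OccursIn l p (Window l n) (restrictWindow l n u) ↔
      OccursIn l p (HDom l) (hcat l (block l u n) (block l u (n + 1))) := by
  constructor
  · refine fun h => h.translate (-(n * l), 0) (fun s hs => ?_) fun s => ?_
    · obtain ⟨⟨h₁, h₂⟩, h₃, h₄⟩ := hs
      refine ⟨⟨?_, ?_⟩, ?_, ?_⟩ <;> simp only [Prod.fst_add, Prod.snd_add] <;> linarith
    · rw [hcat_block_apply]
      exact congrArg u (Subtype.ext (Prod.ext (by simp) (by simp)))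
  · refine fun h => h.translate (n * l, 0) (fun s hs => ?_) fun s => ?_
    · obtain ⟨⟨h₁, h₂⟩, h₃, h₄⟩ := hs
      refine ⟨⟨?_, ?_⟩, ?_, ?_⟩ <;> simp only [Prod.fst_add, Prod.snd_add] <;> linarith
    · rw [hcat_block_apply]
      exact congrArg u (Subtype.ext (Prod.ext (by simp) (by simp)))

theorem admissibleStrip_iff_window {A : Type*} {l : ℕ} (hl : 1 ≤ l) (C : Set (Q l → A))
    (u : StripDom l → A) :
    AdmissibleStrip l C u ↔
      ∀ n : ℤ, ∀ p ∈ C, ¬ OccursIn l p (Window l n) (restrictWindow l n u) := by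
  simp only [AdmissibleStrip, occursIn_strip_iff hl, not_exists]
  exact ⟨fun h n p hp => h p hp n, fun h p hp n => h n p hp⟩

theorem admissibleStrip_iff_blockRel {A : Type*} {l : ℕ} (hl : 1 ≤ l) (C : Set (Q l → A))
    (u : StripDom l → A) :
    AdmissibleStrip l C u ↔ ∀ n : ℤ, BlockRel l C (block l u n) (block l u (n + 1)) := by
  simp only [admissibleStrip_iff_window hl, occursIn_window_iff, BlockRel]

theorem block_bijective {A : Type*} {l : ℕ} (hl : 1 ≤ l) :
    Function.Bijective (fun (u : StripDom l → A) (n : ℤ) => block l u n) := by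
  have hl' : (0 : ℤ) < l := by omega
  have hmod (i : ℤ) : 0 ≤ i % l ∧ i % l < l :=
    ⟨Int.emod_nonneg i hl'.ne', Int.emod_lt_of_pos i hl'⟩
  constructor
  · intro u v huv
    funext s
    have h := congrFun (congrFun huv (s.1.1 / l)) ⟨(s.1.1 % l, s.1.2), hmod _, s.2⟩
    simpa only [block, Int.ediv_mul_add_emod] using h
  · intro y
    refine ⟨fun s => y (s.1.1 / l) ⟨(s.1.1 % l, s.1.2), hmod _, s.2⟩, ?_⟩
    funext n s
    have hs := s.2.1
    have hdiv : (n * l + s.1.1) / l = n := by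
      rw [add_comm, Int.add_mul_ediv_right _ _ hl'.ne', Int.ediv_eq_zero_of_lt hs.1 hs.2,
        zero_add]
    have hrem : (n * l + s.1.1) % l = s.1.1 := by
      rw [add_comm, Int.add_mul_emod_self_right, Int.emod_eq_of_lt hs.1 hs.2]
    simp only [block, hdiv, hrem]

end SFT2

/-- a strip `u` is admissible iff for every `n ∈ ℤ` no pattern of `C`
occurs in the restriction of `u` to `{n·l,…,(n+2)·l − 1} × {0,…,l−1}`; consequently,
`u ↦ (B_n(u))_{n∈ℤ}` is a bijection from the set of admissible strips onto the
one-dimensional vertex shift over the finite alphabet `A^{Q_l}` whose transition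
relation allows `(p,q)` exactly when the `2l × l` block formed by placing `q` to the
right of `p` contains no occurrence of a pattern of `C`. -/
theorem stmt9 {A : Type*} [Finite A] [Nonempty A] (l : ℕ) (hl : 1 ≤ l)
    (C : Set (SFT2.Q l → A)) :
    (∀ u : SFT2.StripDom l → A, SFT2.AdmissibleStrip l C u ↔
        ∀ n : ℤ, ∀ p ∈ C,
          ¬ SFT2.OccursIn l p (SFT2.Window l n) (SFT2.restrictWindow l n u)) ∧
      Set.BijOn (fun (u : SFT2.StripDom l → A) => fun n : ℤ => SFT2.block l u n)
        {u : SFT2.StripDom l → A | SFT2.AdmissibleStrip l C u}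
        {y : ℤ → (SFT2.Q l → A) | ∀ n : ℤ, SFT2.BlockRel l C (y n) (y (n + 1))} := by
  refine ⟨SFT2.admissibleStrip_iff_window hl C, ?_, (SFT2.block_bijective hl).1.injOn, ?_⟩
  · exact fun u hu => (SFT2.admissibleStrip_iff_blockRel hl C u).1 hu
  · intro y hy
    obtain ⟨u, rfl⟩ := (SFT2.block_bijective hl).2 y
    exact ⟨u, (SFT2.admissibleStrip_iff_blockRel hl C u).2 hy, rfl⟩
end

section
/- Let A be a finite nonempty alphabet, d ≥ 2, l ≥ 1, and C ⊆ A^{Q} a set of patterns on the cube Q = {0,…,l−1}^d. For every configuration x : ℤ^d → A, x belongs to X_C if and only if for every n ∈ ℤ the ordered pair of consecutive slabs (S_n(x), S_{n+1}(x)) is an admissible pair. Consequently, the map x ↦ (S_n(x))_{n∈ℤ} is a bijection from X_C onto the set of bi-infinite sequences of slabs in which every consecutive pair is an admissible pair. -/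
namespace SFTd

variable {A : Type*}

/-- We identify `ℤ^d` with `ℤ^{d−1} × ℤ` (the last coordinate split off), so a
point of `ℤ^d` is a pair `(i, j)` with `i : Fin (d-1) → ℤ` and `j : ℤ`. -/
abbrev V (d : ℕ) := (Fin (d - 1) → ℤ) × ℤ

/-- The cube `Q = {0,…,l−1}^d` as a subset of `ℤ^d = ℤ^{d−1} × ℤ`. -/
def Q (d l : ℕ) : Set (V d) :=
  {s | (∀ i, 0 ≤ s.1 i ∧ s.1 i < (l : ℤ)) ∧ (0 ≤ s.2 ∧ s.2 < (l : ℤ))}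

/-- A pattern `p : Q → A` occurs in a function `x : T → A`: there is `b ∈ ℤ^d` with
`b + Q ⊆ T` such that `x (b + s) = p s` for all `s ∈ Q`. -/
def OccursIn (d l : ℕ) (p : Q d l → A) (T : Set (V d)) (x : T → A) : Prop :=
  ∃ b : V d, ∃ h : ∀ s ∈ Q d l, b + s ∈ T,
    ∀ s : Q d l, x ⟨b + s.1, h s.1 s.2⟩ = p s

/-- A pattern `p : Q → A` occurs in a full configuration `x : ℤ^d → A`. -/
def OccursCfg (d l : ℕ) (p : Q d l → A) (x : V d → A) : Prop :=
  ∃ b : V d, ∀ s : Q d l, x (b + s.1) = p s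

/-- The subshift of finite type determined by the forbidden set `C ⊆ A^Q`. -/
def XC (d l : ℕ) (C : Set (Q d l → A)) : Set (V d → A) :=
  {x | ∀ p ∈ C, ¬ OccursCfg d l p x}

/-- The domain `ℤ^{d−1} × {0,…,l−1}` of slabs. -/
def SlabDom (d l : ℕ) : Set (V d) := {s | 0 ≤ s.2 ∧ s.2 < (l : ℤ)}

/-- The domain `ℤ^{d−1} × {0,…,2l−1}` of stacks of two slabs. -/
def StackDom (d l : ℕ) : Set (V d) := {s | 0 ≤ s.2 ∧ s.2 < 2 * (l : ℤ)}

/-- The stack of two slabs: `u` on levels `0,…,l−1` and `v` on levels `l,…,2l−1`. -/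
def stack (d l : ℕ) (u v : SlabDom d l → A) : StackDom d l → A :=
  fun s =>
    if h : s.1.2 < (l : ℤ) then u ⟨s.1, ⟨s.2.1, h⟩⟩
    else v ⟨(s.1.1, s.1.2 - l), ⟨by have := s.2.1; omega, by have := s.2.2; omega⟩⟩

/-- A slab `u` is admissible if no pattern of `C` occurs in it. -/
def AdmissibleSlab (d l : ℕ) (C : Set (Q d l → A)) (u : SlabDom d l → A) : Prop :=
  ∀ p ∈ C, ¬ OccursIn d l p (SlabDom d l) u

/-- `(u,v)` is an admissible pair if no pattern of `C` occurs in `stack u v`. -/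
def AdmissiblePair (d l : ℕ) (C : Set (Q d l → A)) (u v : SlabDom d l → A) : Prop :=
  ∀ p ∈ C, ¬ OccursIn d l p (StackDom d l) (stack d l u v)

/-- The `n`-th slab of a configuration: `S_n(x)(i,j) = x(i, n·l + j)`. -/
def S (d l : ℕ) (x : V d → A) (n : ℤ) : SlabDom d l → A :=
  fun s => x (s.1.1, n * l + s.1.2)

/-- A family `B` of admissible slabs is complementary if every `u ∈ B` has
`v, w ∈ B` with `(u,v)` and `(w,u)` admissible pairs. -/
def Complementary (d l : ℕ) (C : Set (Q d l → A)) (B : Set (SlabDom d l → A)) : Prop :=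
  (∀ u ∈ B, AdmissibleSlab d l C u) ∧
    ∀ u ∈ B, (∃ v ∈ B, AdmissiblePair d l C u v) ∧ ∃ w ∈ B, AdmissiblePair d l C w u

end SFTd

namespace SFTd

variable {A : Type*}

theorem stack_S_apply (d l : ℕ) (x : V d → A) (n : ℤ) (s : StackDom d l) :
    stack d l (S d l x n) (S d l x (n + 1)) s = x (s.1.1, n * l + s.1.2) := by
  unfold stack S
  split_ifs with h
  · rfl
  · refine congrArg x (Prod.ext rfl ?_)
    change (n + 1) * (l : ℤ) + (s.1.2 - l) = n * l + s.1.2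
    ring

/-- A pattern occurs in a configuration iff it occurs in two consecutive slabs. -/
theorem occursCfg_iff_exists_occursIn_stack {d l : ℕ} (hl : 1 ≤ l) (p : Q d l → A)
    (x : V d → A) :
    OccursCfg d l p x ↔
      ∃ n : ℤ, OccursIn d l p (StackDom d l) (stack d l (S d l x n) (S d l x (n + 1))) := by
  have hl' : (0 : ℤ) < l := by exact_mod_cast hl
  constructor
  · rintro ⟨b, hb⟩
    have h0 := Int.emod_nonneg b.2 hl'.ne'
    have h1 := Int.emod_lt_of_pos b.2 hl'
    refine ⟨b.2 / l, (b.1, b.2 % l), fun s hs => ?_, fun s => ?_⟩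
    · have h2 := hs.2
      change 0 ≤ b.2 % l + s.2 ∧ b.2 % l + s.2 < 2 * (l : ℤ)
      omega
    · rw [stack_S_apply, ← hb s]
      refine congrArg x (Prod.ext rfl ?_)
      change b.2 / l * l + (b.2 % l + s.1.2) = b.2 + s.1.2
      rw [← add_assoc, Int.ediv_mul_add_emod]
  · rintro ⟨n, b, h, hb⟩
    refine ⟨(b.1, n * l + b.2), fun s => ?_⟩
    rw [← hb s, stack_S_apply]
    refine congrArg x (Prod.ext rfl ?_)
    change n * l + b.2 + s.1.2 = n * l + (b.2 + s.1.2)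
    ring

theorem mem_XC_iff_admissiblePair {d l : ℕ} (hl : 1 ≤ l) (C : Set (Q d l → A))
    (x : V d → A) :
    x ∈ XC d l C ↔ ∀ n : ℤ, AdmissiblePair d l C (S d l x n) (S d l x (n + 1)) := by
  simp only [XC, AdmissiblePair, Set.mem_ofPred_eq, occursCfg_iff_exists_occursIn_stack hl,
    not_exists]
  exact ⟨fun h n p hp => h p hp n, fun h p hp n => h n p hp⟩

/-- The sequence of slabs determines the configuration, and every sequence arises. -/
theorem bijective_slabs {d l : ℕ} (hl : 1 ≤ l) :
    Function.Bijective (fun (x : V d → A) => fun n : ℤ => S d l x n) := by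
  have hl' : (0 : ℤ) < l := by exact_mod_cast hl
  have hmod (j : ℤ) : 0 ≤ j % l ∧ j % l < l :=
    ⟨Int.emod_nonneg j hl'.ne', Int.emod_lt_of_pos j hl'⟩
  constructor
  · intro x y hxy
    funext ⟨i, j⟩
    have h : x (i, j / l * l + j % l) = y (i, j / l * l + j % l) :=
      congrFun (congrFun hxy (j / l)) ⟨(i, j % l), hmod j⟩
    rwa [Int.ediv_mul_add_emod] at h
  · intro u
    refine ⟨fun s => u (s.2 / l) ⟨(s.1, s.2 % l), hmod s.2⟩, ?_⟩
    funext n ⟨⟨i, j⟩, hj⟩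
    have hq : (n * l + j) / l = n := by
      rw [add_comm, Int.add_mul_ediv_right _ _ hl'.ne', Int.ediv_eq_zero_of_lt hj.1 hj.2,
        zero_add]
    have hr : (n * l + j) % l = j := by
      rw [add_comm, Int.add_mul_emod_self_right, Int.emod_eq_of_lt hj.1 hj.2]
    simp only [S, hq, hr]

end SFTd

/-- a configuration `x : ℤ^d → A` belongs to `X_C` iff every pair of
consecutive slabs `(S_n(x), S_{n+1}(x))` is an admissible pair; consequently
`x ↦ (S_n(x))_{n∈ℤ}` is a bijection from `X_C` onto the set of bi-infinite
sequences of slabs in which every consecutive pair is admissible. -/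
theorem stmt10 {A : Type*} [Finite A] [Nonempty A] (d l : ℕ) (hd : 2 ≤ d)
    (hl : 1 ≤ l) (C : Set (SFTd.Q d l → A)) :
    (∀ x : SFTd.V d → A, x ∈ SFTd.XC d l C ↔
        ∀ n : ℤ, SFTd.AdmissiblePair d l C (SFTd.S d l x n) (SFTd.S d l x (n + 1))) ∧
      Set.BijOn (fun (x : SFTd.V d → A) => fun n : ℤ => SFTd.S d l x n)
        (SFTd.XC d l C)
        {u : ℤ → (SFTd.SlabDom d l → A) |
          ∀ n : ℤ, SFTd.AdmissiblePair d l C (u n) (u (n + 1))} := by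
  refine ⟨SFTd.mem_XC_iff_admissiblePair hl C,
    fun x hx => (SFTd.mem_XC_iff_admissiblePair hl C x).1 hx,
    (SFTd.bijective_slabs hl).injective.injOn, fun u hu => ?_⟩
  obtain ⟨x, rfl⟩ := (SFTd.bijective_slabs hl).surjective u
  exact ⟨x, (SFTd.mem_XC_iff_admissiblePair hl C x).2 hu, rfl⟩
end

section
/- Let A be a finite nonempty alphabet, d ≥ 2, l ≥ 1, and C ⊆ A^{Q} with Q = {0,…,l−1}^d. The subshift X_C is nonempty if and only if there exists a nonempty complementary family B₀ of admissible slabs, i.e., a nonempty set B₀ of admissible slabs such that for every u ∈ B₀ there exist v, w ∈ B₀ for which (u,v) and (w,u) are admissible pairs. -/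
namespace SFTd

/-- A pattern occurring in a stack of two consecutive slabs of `x` occurs in `x`. -/
lemma admissiblePair_S {A : Type*} {d l : ℕ} {C : Set (Q d l → A)} {x : V d → A}
    (hx : x ∈ XC d l C) (n : ℤ) : AdmissiblePair d l C (S d l x n) (S d l x (n + 1)) := by
  rintro p hp ⟨b, hb, h⟩
  refine hx p hp ⟨(b.1, n * l + b.2), fun s => ?_⟩
  rw [← h s]
  unfold stack S
  split_ifs with hs
  · exact congrArg x (Prod.ext rfl (by simp [add_assoc]))
  · exact congrArg x (Prod.ext rfl (by simp; ring))

/-- Every slab of a point of `X_C` is admissible. -/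
lemma admissibleSlab_S {A : Type*} {d l : ℕ} {C : Set (Q d l → A)} {x : V d → A}
    (hx : x ∈ XC d l C) (n : ℤ) : AdmissibleSlab d l C (S d l x n) := by
  rintro p hp ⟨b, hb, h⟩
  refine hx p hp ⟨(b.1, n * l + b.2), fun s => ?_⟩
  rw [← h s]
  exact congrArg x (Prod.ext rfl (by simp [add_assoc]))

/-- A relation that is total to the right and to the left admits a bi-infinite chain. -/
lemma exists_int_chain {α : Type*} [Nonempty α] {r : α → α → Prop}
    (hright : ∀ a, ∃ b, r a b) (hleft : ∀ a, ∃ b, r b a) :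
    ∃ f : ℤ → α, ∀ n, r (f n) (f (n + 1)) := by
  choose next hnext using hright
  choose prev hprev using hleft
  obtain ⟨a⟩ := ‹Nonempty α›
  refine ⟨fun n => if 0 ≤ n then next^[n.toNat] a else prev^[(-n).toNat] a, fun n => ?_⟩
  rcases le_or_gt 0 n with hn | hn
  · have h1 : (n + 1).toNat = n.toNat + 1 := by omega
    simp only [if_pos hn, if_pos (show 0 ≤ n + 1 by omega), h1, Function.iterate_succ_apply']
    exact hnext _
  · have h1 : (-n).toNat = (-(n + 1)).toNat + 1 := by omega
    simp only [if_neg (not_le.mpr hn), h1, Function.iterate_succ_apply']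
    split_ifs with h
    · obtain rfl : n = -1 := by omega
      exact hprev _
    · exact hprev _

/-- The configuration whose `n`-th slab is `f n`. -/
def glue {A : Type*} {d l : ℕ} (hl : 1 ≤ l) (f : ℤ → SlabDom d l → A) : V d → A :=
  fun s => f (s.2 / l) ⟨(s.1, s.2 % l),
    Int.emod_nonneg _ (by omega), Int.emod_lt_of_pos _ (by omega)⟩

/-- The value of a glued configuration at height `n * l + t` with `0 ≤ t < l`. -/
lemma glue_apply {A : Type*} {d l : ℕ} (hl : 1 ≤ l) (f : ℤ → SlabDom d l → A) (s : V d)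
    {n : ℤ} (t : SlabDom d l) (h1 : s.1 = t.1.1) (h2 : s.2 = n * l + t.1.2) :
    glue hl f s = f n t := by
  obtain ⟨⟨i, j⟩, hj⟩ := t
  obtain ⟨i', j'⟩ := s
  obtain ⟨hj0, hjl⟩ := hj
  dsimp only at h1 h2 hj0 hjl
  subst h1 h2
  have hq : (n * l + j) / (l : ℤ) = n := by
    rw [Int.add_comm, Int.add_mul_ediv_right _ _ (by omega), Int.ediv_eq_zero_of_lt hj0 hjl,
      zero_add]
  have hr : (n * l + j) % (l : ℤ) = j := by
    rw [Int.add_comm, Int.add_mul_emod_self_right, Int.emod_eq_of_lt hj0 hjl]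
  simp only [glue, hq, hr]

/-- Gluing a bi-infinite sequence of slabs with admissible consecutive pairs gives a point
of `X_C`. -/
lemma glue_mem_XC {A : Type*} {d l : ℕ} (hl : 1 ≤ l) {C : Set (Q d l → A)}
    {f : ℤ → SlabDom d l → A} (hf : ∀ n, AdmissiblePair d l C (f n) (f (n + 1))) :
    glue hl f ∈ XC d l C := by
  rintro p hp ⟨b, h⟩
  have h0 := Int.emod_nonneg b.2 (show (l : ℤ) ≠ 0 by omega)
  have h1 := Int.emod_lt_of_pos b.2 (show (0 : ℤ) < l by omega)
  have hdiv : b.2 / l * l + b.2 % l = b.2 := Int.ediv_mul_add_emod _ _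
  refine hf (b.2 / l) p hp ⟨(b.1, b.2 % l), ?_, fun s => ?_⟩
  · rintro s ⟨-, hs0, hs1⟩
    constructor <;> simp only [Prod.snd_add] <;> omega
  · rw [← h s]
    unfold stack
    split_ifs with hs
    · refine (glue_apply hl f (b + s.1) _ rfl ?_).symm
      simp only [Prod.snd_add]
      linarith
    · refine (glue_apply hl f (b + s.1) _ rfl ?_).symm
      simp only [Prod.snd_add]
      linarith

end SFTd

/-- `X_C` is nonempty iff there is a nonempty complementary family of
admissible slabs. -/
theorem stmt11 {A : Type*} [Finite A] [Nonempty A] (d l : ℕ) (hd : 2 ≤ d)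
    (hl : 1 ≤ l) (C : Set (SFTd.Q d l → A)) :
    (SFTd.XC d l C).Nonempty ↔
      ∃ B : Set (SFTd.SlabDom d l → A), B.Nonempty ∧ SFTd.Complementary d l C B := by
  constructor
  · rintro ⟨x, hx⟩
    refine ⟨Set.range (SFTd.S d l x), Set.range_nonempty _, ?_, ?_⟩
    · rintro _ ⟨n, rfl⟩
      exact SFTd.admissibleSlab_S hx n
    · rintro _ ⟨n, rfl⟩
      refine ⟨⟨_, ⟨n + 1, rfl⟩, SFTd.admissiblePair_S hx n⟩, _, ⟨n - 1, rfl⟩, ?_⟩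
      simpa using SFTd.admissiblePair_S hx (n - 1)
  · rintro ⟨B, hB, -, hpair⟩
    have := hB.to_subtype
    obtain ⟨f, hf⟩ := SFTd.exists_int_chain
      (r := fun u v : B => SFTd.AdmissiblePair d l C u.1 v.1)
      (fun u => let ⟨v, hv, h⟩ := (hpair u u.2).1; ⟨⟨v, hv⟩, h⟩)
      (fun u => let ⟨w, hw, h⟩ := (hpair u u.2).2; ⟨⟨w, hw⟩, h⟩)
    exact ⟨_, SFTd.glue_mem_XC hl (f := fun n => (f n).1) hf⟩
end

section
/- Let A be a finite nonempty alphabet, d ≥ 2, l ≥ 1, and C ⊆ A^{Q} with Q = {0,…,l−1}^d. If there exists a finite nonempty complementary family B₀ of admissible slabs, then X_C contains a point periodic in the d-th coordinate direction: there exist x ∈ X_C and an integer k ≥ 1 such that x(i, j + k) = x(i, j) for all i ∈ ℤ^{d−1} and j ∈ ℤ. -/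
namespace SFTd

variable {A : Type*}

/-- A self-map of a finite nonempty type has an orbit that is periodic and indexed by `ℤ`. -/
theorem exists_periodic_int_orbit {α : Type*} [Finite α] [Nonempty α] (f : α → α) :
    ∃ (w : ℤ → α) (k : ℤ), 1 ≤ k ∧ (∀ n, w (n + 1) = f (w n)) ∧ ∀ n, w (n + k) = w n := by
  obtain ⟨z₀⟩ := ‹Nonempty α›
  obtain ⟨a, b, hab, h⟩ : ∃ a b : ℕ, a < b ∧ f^[a] z₀ = f^[b] z₀ := by
    obtain ⟨a, b, hne, h⟩ := Finite.exists_ne_map_eq_of_infinite (fun n : ℕ => f^[n] z₀)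
    rcases lt_or_gt_of_ne hne with hlt | hlt
    · exact ⟨a, b, hlt, h⟩
    · exact ⟨b, a, hlt, h.symm⟩
  have hper : Function.IsPeriodicPt f (b - a) (f^[a] z₀) := by
    change f^[b - a] (f^[a] z₀) = f^[a] z₀
    rw [← Function.iterate_add_apply, Nat.sub_add_cancel hab.le, h]
  obtain ⟨k, hk⟩ : ∃ k, k = b - a := ⟨_, rfl⟩
  rw [← hk] at hper
  have hk0 : (k : ℤ) ≠ 0 := by omega
  refine ⟨fun n => f^[(n % (k : ℤ)).toNat] (f^[a] z₀), k, by omega, fun n => ?_, fun n => ?_⟩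
  · have hmod : ((n + 1) % (k : ℤ)).toNat = ((n % (k : ℤ)).toNat + 1) % k := by
      zify
      rw [Int.toNat_of_nonneg (Int.emod_nonneg _ hk0), Int.toNat_of_nonneg (Int.emod_nonneg _ hk0),
        Int.emod_add_emod]
    simp only [hmod, hper.iterate_mod_apply, Function.iterate_succ_apply']
  · simp only [Int.add_emod_right]

/-- The configuration whose consecutive slabs are the terms of `w`. -/
def stackAll (d l : ℕ) (hl : 1 ≤ l) (w : ℤ → SlabDom d l → A) : V d → A :=
  fun s => w (s.2 / l) ⟨(s.1, s.2 % l), Int.emod_nonneg _ (by omega),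
    Int.emod_lt_of_pos _ (by omega)⟩

/-- A configuration formed by stacking slabs with admissible consecutive pairs avoids `C`. -/
theorem stackAll_mem_XC (d l : ℕ) (hl : 1 ≤ l) (C : Set (Q d l → A)) (w : ℤ → SlabDom d l → A)
    (hw : ∀ n, AdmissiblePair d l C (w n) (w (n + 1))) : stackAll d l hl w ∈ XC d l C := by
  rintro p hp ⟨b, hb⟩
  have hl0 : (0 : ℤ) < l := by omega
  have h0 := Int.emod_nonneg b.2 hl0.ne'
  have h1 := Int.emod_lt_of_pos b.2 hl0
  have hdiv := Int.mul_ediv_add_emod b.2 l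
  refine hw (b.2 / l) p hp ⟨(b.1, b.2 % l), fun s hs => ?_, fun s => ?_⟩
  · have := hs.2
    constructor <;> simp only [Prod.snd_add] <;> omega
  · rw [← hb s]
    have hs := s.2.2
    unfold stack stackAll
    split_ifs with hlt
    all_goals simp only [Prod.snd_add, Prod.fst_add] at hlt ⊢
    · obtain ⟨hq, hr⟩ := (Int.ediv_emod_unique (a := b.2 + s.1.2) (q := b.2 / l)
        (r := b.2 % l + s.1.2) hl0).2 ⟨by linarith, by omega, hlt⟩
      simp only [hq, hr]
      rfl
    · obtain ⟨hq, hr⟩ := (Int.ediv_emod_unique (a := b.2 + s.1.2) (q := b.2 / l + 1)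
        (r := b.2 % l + s.1.2 - l) hl0).2 ⟨by linarith, by omega, by omega⟩
      simp only [hq, hr]

end SFTd

/-- if there is a finite nonempty complementary family of admissible
slabs, then `X_C` contains a point periodic in the `d`-th coordinate direction. -/
theorem stmt12 {A : Type*} [Finite A] [Nonempty A] (d l : ℕ) (hd : 2 ≤ d)
    (hl : 1 ≤ l) (C : Set (SFTd.Q d l → A)) (B : Set (SFTd.SlabDom d l → A))
    (hfin : B.Finite) (hne : B.Nonempty) (hcomp : SFTd.Complementary d l C B) :
    ∃ x ∈ SFTd.XC d l C, ∃ k : ℤ, 1 ≤ k ∧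
      ∀ (i : Fin (d - 1) → ℤ) (j : ℤ), x (i, j + k) = x (i, j) := by
  have : Finite B := hfin
  have : Nonempty B := hne.to_subtype
  choose g hgB hg using fun u : B => (hcomp.2 u u.2).1
  obtain ⟨w, k, hk, hstep, hper⟩ := SFTd.exists_periodic_int_orbit fun u : B => (⟨g u, hgB u⟩ : B)
  refine ⟨SFTd.stackAll d l hl fun n => w n, SFTd.stackAll_mem_XC d l hl C _ fun n => ?_,
    k * l, ?_, fun i j => ?_⟩
  · rw [hstep]
    exact hg (w n)
  · exact one_le_mul_of_one_le_of_one_le hk (by exact_mod_cast hl)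
  · have hl0 : (l : ℤ) ≠ 0 := by omega
    simp only [SFTd.stackAll, Int.add_mul_ediv_right _ _ hl0, Int.add_mul_emod_self_right, hper]
end
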